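/- For all integers d and e, every (d,e)-weighted hypermobile has excess equal to −e. -/

import Mathlib

open Finset

/-- The three types of vertices of a hypermobile: round, dark square, light square. -/
inductive HColor
  | round
  | dark
  | light
deriving DecidableEq

/-- The weight of a vertex: the sum of the weights of the incident edges. -/
noncomputable def vertexWeight {V : Type*} [Fintype V] [DecidableEq V]
    (G : SimpleGraph V) [DecidableRel G.Adj] (w : Sym2 V → ℝ) (v : V) : ℝ :=
  ∑ u ∈ G.neighborFinset v, w s(v, u)

/-- The degree of a vertex of a hypermobile: its degree in the tree plus its bud count. -/
def vertexDegree {V : Type*} [Fintype V] [DecidableEq V]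
    (G : SimpleGraph V) [DecidableRel G.Adj] (bud : V → ℕ) (v : V) : ℕ :=
  G.degree v + bud v

/-- In a graph whose edges join vertices of opposite sign, the signed sum over all vertices of the
total of a symmetric edge function at each vertex vanishes. -/
theorem sum_sign_mul_sum_neighborFinset_eq_zero {V : Type*} [Fintype V] [DecidableEq V]
    (G : SimpleGraph V) [DecidableRel G.Adj] (s : V → ℝ)
    (hs : ∀ u v, G.Adj u v → s u = -s v) (f : Sym2 V → ℝ) :
    ∑ v, s v * ∑ u ∈ G.neighborFinset v, f s(v, u) = 0 := by
  have expand : ∑ v, s v * ∑ u ∈ G.neighborFinset v, f s(v, u)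
      = ∑ v, ∑ u, if G.Adj v u then s v * f s(v, u) else 0 := by
    refine sum_congr rfl fun v _ => ?_
    rw [mul_sum, SimpleGraph.neighborFinset_eq_filter, sum_filter]
  have swap : ∑ v, ∑ u, (if G.Adj v u then s v * f s(v, u) else 0)
      = -∑ v, ∑ u, if G.Adj v u then s v * f s(v, u) else 0 := by
    conv_lhs => rw [sum_comm]
    simp only [← sum_neg_distrib]
    refine sum_congr rfl fun v _ => sum_congr rfl fun u _ => ?_
    by_cases h : G.Adj v u
    · rw [if_pos h, if_pos h.symm, hs u v h.symm, Sym2.eq_swap, neg_mul]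
    · rw [if_neg h, if_neg fun h' => h h'.symm, neg_zero]
  linarith

/-- The number of edges meeting an independent set of vertices is the sum of the degrees of its
elements. -/
theorem card_edgeFinset_filter_exists_mem_eq_sum_degree {V : Type*} [Fintype V] [DecidableEq V]
    (G : SimpleGraph V) [DecidableRel G.Adj] (p : V → Prop) [DecidablePred p]
    [DecidablePred fun ed : Sym2 V => ∃ v ∈ ed, p v]
    (hp : ∀ u v, G.Adj u v → p u → ¬ p v) :
    (G.edgeFinset.filter (fun ed => ∃ v ∈ ed, p v)).card
      = ∑ v ∈ univ.filter p, G.degree v := by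
  have key : G.edgeFinset.filter (fun ed => ∃ v ∈ ed, p v)
      = (univ.filter p).biUnion fun v => G.incidenceFinset v := by
    ext ed
    simp only [mem_filter, mem_biUnion, mem_univ, true_and, SimpleGraph.mem_incidenceFinset,
      SimpleGraph.incidenceSet, Set.mem_ofPred_eq, SimpleGraph.mem_edgeFinset]
    exact ⟨fun ⟨h, v, hv, hpv⟩ => ⟨v, hpv, h, hv⟩, fun ⟨v, hpv, h, hv⟩ => ⟨h, v, hv, hpv⟩⟩
  rw [key, card_biUnion]
  · simp only [SimpleGraph.card_incidenceFinset_eq_degree]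
  · intro u hu v hv huv
    refine disjoint_left.2 ?_
    intro ed hedu hedv
    rw [SimpleGraph.mem_incidenceFinset] at hedu hedv
    have hed : ed = s(u, v) := (Sym2.mem_and_mem_iff huv).1 ⟨hedu.2, hedv.2⟩
    have hadj : G.Adj u v := by
      have := hedu.1
      rwa [hed, SimpleGraph.mem_edgeSet] at this
    exact hp u v hadj (mem_filter.1 hu).2 (mem_filter.1 hv).2

/-- For all integers `d` and `e`, every `(d,e)`-weighted hypermobile has excess `−e`; the
excess is the number of edges with a round endpoint minus the total number of buds. -/
theorem de_weighted_hypermobile_excess {V : Type*} [Fintype V] [DecidableEq V]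
    (d e : ℤ)
    (G : SimpleGraph V) [DecidableRel G.Adj] (hG : G.IsTree)
    (color : V → HColor) (bud : V → ℕ)
    (hbud : ∀ v, color v ≠ HColor.light → bud v = 0)
    (hedge : ∀ u v, G.Adj u v → (color u = HColor.dark ↔ ¬ color v = HColor.dark))
    (w : Sym2 V → ℝ)
    (v₁ : V) (hv₁ : color v₁ ≠ HColor.round)
    (hposw : ∀ u v, G.Adj u v → color u = HColor.round → 0 < w s(u, v))
    (hnegw : ∀ u v, G.Adj u v → color u = HColor.light → w s(u, v) ≤ 0)
    (hround : ∀ v, color v = HColor.round → vertexWeight G w v = d)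
    (hlight : ∀ v, color v = HColor.light → v ≠ v₁ →
      vertexWeight G w v = d - vertexDegree G bud v)
    (hdark : ∀ v, color v = HColor.dark → v ≠ v₁ →
      vertexWeight G w v = d * vertexDegree G bud v - d - vertexDegree G bud v)
    (hmarkedLight : color v₁ = HColor.light →
      vertexWeight G w v₁ = e - vertexDegree G bud v₁)
    (hmarkedDark : color v₁ = HColor.dark →
      vertexWeight G w v₁ = d * vertexDegree G bud v₁ - e - vertexDegree G bud v₁) :
    ((G.edgeFinset.filter (fun ed => ∃ v ∈ ed, color v = HColor.round)).card : ℝ)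
        - ∑ v : V, (bud v : ℝ)
      = -(e : ℝ) := by
  classical
  set s : V → ℝ := fun v => if color v = HColor.dark then -1 else 1 with hs
  have hanti : ∀ u v, G.Adj u v → s u = -s v := by
    intro u v h
    have := hedge u v h
    by_cases hv : color v = HColor.dark <;> simp_all
  have weights : ∑ v, s v * vertexWeight G w v = 0 :=
    sum_sign_mul_sum_neighborFinset_eq_zero G s hanti w
  have degrees : ∑ v, s v * (G.degree v : ℝ) = 0 := by
    simpa using sum_sign_mul_sum_neighborFinset_eq_zero G s hanti fun _ => 1
  have handshake : ∑ v, (G.degree v : ℝ) = 2 * (G.edgeFinset.card : ℝ) := by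
    exact_mod_cast G.sum_degrees_eq_twice_card_edges
  have euler : (G.edgeFinset.card : ℝ) + 1 = Fintype.card V := by
    exact_mod_cast hG.card_edgeFinset
  have roundEdges :
      ((G.edgeFinset.filter (fun ed => ∃ v ∈ ed, color v = HColor.round)).card : ℝ)
        = ∑ v, if color v = HColor.round then (G.degree v : ℝ) else 0 := by
    rw [card_edgeFinset_filter_exists_mem_eq_sum_degree G (fun v => color v = HColor.round),
      Nat.cast_sum, sum_filter]
    intro u v h hu hv
    simpa [hu, hv] using hedge u v h
  have vertex : ∀ v, s v * vertexWeight G w v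
      = d - bud v + (if color v = HColor.round then (G.degree v : ℝ) else 0)
        + (d / 2) * (s v * G.degree v) - s v * G.degree v - (d / 2) * G.degree v
        + if v = v₁ then (e : ℝ) - d else 0 := by
    intro v
    have hb := hbud v
    by_cases h : v = v₁
    · subst h
      rcases hc : color v with _ | _ | _
      · exact absurd hc hv₁
      · rw [hmarkedDark hc]
        simp [hs, hc, vertexDegree, hb]
        ring
      · rw [hmarkedLight hc]
        simp [hs, hc, vertexDegree]
        ring
    · rcases hc : color v with _ | _ | _
      · rw [hround v hc]
        simp [hs, hc, h, hb]
        ring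
      · rw [hdark v hc h]
        simp [hs, hc, h, vertexDegree, hb]
        ring
      · rw [hlight v hc h]
        simp [hs, hc, h, vertexDegree]
        ring
  rw [sum_congr rfl fun v _ => vertex v] at weights
  simp only [sum_add_distrib, sum_sub_distrib, ← mul_sum, degrees, handshake, ← roundEdges,
    sum_ite_eq', mem_univ, if_true, sum_const, card_univ, nsmul_eq_mul, ← euler] at weights
  linarith
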